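/- arXiv:math-ph/0410049 — 3 statements merged into one kernel-verified Lean document; each statement's English description precedes it below -/
import Mathlib

section
/- If the pair (U,V) of bounded linear operators on H satisfies the symplectic relations (so that U is invertible), then 1 − (U⁻¹V)(U⁻¹V)* = (U*U)⁻¹ and 1 − (V̄U⁻¹)*(V̄U⁻¹) = (UU*)⁻¹. -/
open ContinuousLinearMap
open scoped InnerProductSpace

variable {H : Type*} [NormedAddCommGroup H] [InnerProductSpace ℂ H] [CompleteSpace H]

/-- The complex conjugate `Ā := J ∘ A ∘ J` of a bounded operator with respect to the
conjugation `J`. -/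
noncomputable def conjOp (J : H →L⋆[ℂ] H) (A : H →L[ℂ] H) : H →L[ℂ] H :=
  (J.comp A).comp J

/-- The transpose `Aᵀ := J ∘ A* ∘ J` of a bounded operator with respect to the
conjugation `J`. -/
noncomputable def transp (J : H →L⋆[ℂ] H) (A : H →L[ℂ] H) : H →L[ℂ] H :=
  conjOp J (adjoint A)

/-- The pair `(U, V)` satisfies the symplectic relations:
`U U* − V V* = 1`, `U Vᵀ = V Uᵀ`, `U* U − Vᵀ V̄ = 1`, `Uᵀ V̄ = V* U`. -/
def SymplecticPair (J : H →L⋆[ℂ] H) (U V : H →L[ℂ] H) : Prop :=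
  U ∘L adjoint U - V ∘L adjoint V = 1 ∧
  U ∘L transp J V = V ∘L transp J U ∧
  adjoint U ∘L U - transp J V ∘L conjOp J V = 1 ∧
  transp J U ∘L conjOp J V = adjoint V ∘L U

theorem conjugation_inner {E : Type*} [NormedAddCommGroup E] [InnerProductSpace ℂ E]
    (J : E →L⋆[ℂ] E) (hJnorm : ∀ x, ‖J x‖ = ‖x‖) (x y : E) :
    ⟪J x, J y⟫_ℂ = ⟪y, x⟫_ℂ := by
  have hadd : ‖J x + J y‖ = ‖y + x‖ := by rw [← map_add, hJnorm, add_comm]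
  have hsub : ‖J x - J y‖ = ‖y - x‖ := by rw [← map_sub, hJnorm, norm_sub_rev]
  have hsubI : ‖J x - Complex.I • J y‖ = ‖y - Complex.I • x‖ := by
    have h₁ : J x - Complex.I • J y = J (x + Complex.I • y) := by
      simp [map_smulₛₗ, sub_eq_add_neg]
    have h₂ : y - Complex.I • x = -Complex.I • (x + Complex.I • y) := by
      simp [smul_smul, smul_add]; abel
    rw [h₁, h₂, hJnorm, norm_smul]; simp
  have haddI : ‖J x + Complex.I • J y‖ = ‖y + Complex.I • x‖ := by
    have h₁ : J x + Complex.I • J y = J (x - Complex.I • y) := by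
      simp [map_smulₛₗ, sub_eq_add_neg]
    have h₂ : y + Complex.I • x = Complex.I • (x - Complex.I • y) := by
      simp [smul_smul, smul_sub]; abel
    rw [h₁, h₂, hJnorm, norm_smul]; simp
  rw [inner_eq_sum_norm_sq_div_four, inner_eq_sum_norm_sq_div_four y x]
  simp only [RCLike.I_to_complex]
  rw [hadd, hsub, hsubI, haddI]

/-- The transpose is the adjoint of the complex conjugate. -/
theorem adjoint_conjOp (J : H →L⋆[ℂ] H) (hJinv : ∀ x, J (J x) = x)
    (hJnorm : ∀ x, ‖J x‖ = ‖x‖) (A : H →L[ℂ] H) :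
    adjoint (conjOp J A) = transp J A := by
  symm
  rw [eq_adjoint_iff]
  intro x y
  calc ⟪J (adjoint A (J x)), y⟫_ℂ = ⟪J (adjoint A (J x)), J (J y)⟫_ℂ := by rw [hJinv]
    _ = ⟪A (J y), J x⟫_ℂ := by rw [conjugation_inner J hJnorm, adjoint_inner_right]
    _ = ⟪J (J x), J (A (J y))⟫_ℂ := (conjugation_inner J hJnorm _ _).symm
    _ = ⟪x, J (A (J y))⟫_ℂ := by rw [hJinv]

theorem isUnit_of_isUnit_mul_star_of_isUnit_star_mul {R : Type*} [Monoid R] [StarMul R] {u : R}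
    (hr : IsUnit (u * star u)) (hl : IsUnit (star u * u)) : IsUnit u := by
  obtain ⟨b, hb⟩ := hr.exists_right_inv
  obtain ⟨c, hc⟩ := hl.exists_left_inv
  exact isUnit_iff_exists_and_exists.2
    ⟨⟨star u * b, by rw [← mul_assoc, hb]⟩, ⟨c * star u, by rw [mul_assoc, hc]⟩⟩

theorem one_sub_inverse_mul_mul_star {R : Type*} [Ring R] [StarRing R] {u v : R}
    (hu : IsUnit u) (h : u * star u - v * star v = 1) :
    1 - (Ring.inverse u * v) * star (Ring.inverse u * v) = Ring.inverse (star u * u) := by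
  obtain ⟨u, rfl⟩ := hu
  rw [← Units.coe_star, ← Units.val_mul, Ring.inverse_unit, Ring.inverse_unit, mul_inv_rev,
    Units.val_mul, star_mul, ← Units.coe_star, star_inv]
  have hv : v * star v = u * star (u : R) - 1 := by rw [← h]; abel
  calc 1 - (↑u⁻¹ * v) * (star v * ↑(star u)⁻¹)
      = 1 - ↑u⁻¹ * (v * star v) * ↑(star u)⁻¹ := by simp only [mul_assoc]
    _ = ↑u⁻¹ * ↑(star u)⁻¹ := by
      rw [hv, ← Units.coe_star, mul_sub, Units.inv_mul_cancel_left, sub_mul, Units.mul_inv,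
        mul_one, sub_sub_cancel]

theorem one_sub_star_mul_inverse_mul {R : Type*} [Ring R] [StarRing R] {u w : R}
    (hu : IsUnit u) (h : star u * u - star w * w = 1) :
    1 - star (w * Ring.inverse u) * (w * Ring.inverse u) = Ring.inverse (u * star u) := by
  have key := one_sub_inverse_mul_mul_star (u := star u) (v := star w) hu.star (by simpa using h)
  rwa [Ring.inverse_star, ← star_mul, star_star, star_star] at key

theorem isUnit_of_sub_eq_one {p q : H →L[ℂ] H} (hq : 0 ≤ q) (h : p - q = 1) : IsUnit p := by
  refine CStarAlgebra.isUnit_of_le 1 ?_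
  rw [← h]
  exact sub_le_self p hq

/-- If `(U,V)` satisfies the symplectic relations then
`1 − (U⁻¹V)(U⁻¹V)* = (U*U)⁻¹` and `1 − (V̄U⁻¹)*(V̄U⁻¹) = (UU*)⁻¹`. -/
theorem statement5 (J : H →L⋆[ℂ] H) (hJinv : ∀ x, J (J x) = x) (hJnorm : ∀ x, ‖J x‖ = ‖x‖)
    (U V : H →L[ℂ] H) (h : SymplecticPair J U V) :
    1 - (Ring.inverse U ∘L V) ∘L adjoint (Ring.inverse U ∘L V)
      = Ring.inverse (adjoint U ∘L U) ∧
    1 - adjoint (conjOp J V ∘L Ring.inverse U) ∘L (conjOp J V ∘L Ring.inverse U)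
      = Ring.inverse (U ∘L adjoint U) := by
  obtain ⟨h₁, -, h₂, -⟩ := h
  rw [← adjoint_conjOp J hJinv hJnorm] at h₂
  have hU : IsUnit U := isUnit_of_isUnit_mul_star_of_isUnit_star_mul
    (isUnit_of_sub_eq_one (mul_star_self_nonneg V) h₁)
    (isUnit_of_sub_eq_one (star_mul_self_nonneg (conjOp J V)) h₂)
  exact ⟨one_sub_inverse_mul_mul_star hU h₁, one_sub_star_mul_inverse_mul hU h₂⟩
end

section
/- Let Z be a transposition-symmetric bounded operator on H with ‖Z‖ < 1. Then 1 − Z Z* is a positive invertible operator; let U denote the inverse of its positive square root, U := (1 − Z Z*)^(−1/2), and set V := U Z. Then the pair (U,V) satisfies the symplectic relations and ζ(U,V; 0) = (U*)⁻¹ Vᵀ = Z. (In particular, the symplectic group acts transitively on the set of transposition-symmetric operators of norm less than one.) -/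
open ContinuousLinearMap
open scoped InnerProductSpace

variable {H : Type*} [NormedAddCommGroup H] [InnerProductSpace ℂ H] [CompleteSpace H]

/-- The Siegel-disc action `ζ(U,V; Z) := (U* + Z V*)⁻¹ (Vᵀ + Z Uᵀ)`. -/
noncomputable def zeta (J : H →L⋆[ℂ] H) (U V Z : H →L[ℂ] H) : H →L[ℂ] H :=
  Ring.inverse (adjoint U + Z ∘L adjoint V) ∘L (transp J V + Z ∘L transp J U)

/-- A Sylvester equation `a d + d b = 0` with `a` positive invertible and `b` positive has only
the trivial solution. -/
theorem eq_zero_of_mul_add_mul_eq_zero {A : Type*} [CStarAlgebra A] [PartialOrder A]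
    [StarOrderedRing A] {a b d : A} (ha : 0 ≤ a) (hau : IsUnit a) (hb : 0 ≤ b)
    (h : a * d + d * b = 0) : d = 0 := by
  have hdb : star d * d * b = -(star d * a * d) := by
    rw [mul_assoc, eq_neg_of_add_eq_zero_right h]; noncomm_ring
  have hpos : 0 ≤ star d * a * d := star_left_conjugate_nonneg ha d
  have hcomm : Commute (star d * d) b := by
    have hs : star (star d * d * b) = star d * d * b := by
      rw [hdb, star_neg, hpos.isSelfAdjoint.star_eq]
    rw [star_mul, hb.isSelfAdjoint.star_eq, star_mul, star_star] at hs
    exact hs.symm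
  have hnonneg : 0 ≤ star d * d * b := hcomm.mul_nonneg (star_mul_self_nonneg d) hb
  have hzero : star d * a * d = 0 :=
    le_antisymm (by rwa [hdb, neg_nonneg] at hnonneg) hpos
  obtain ⟨s, hs, rfl⟩ : ∃ s, IsSelfAdjoint s ∧ a = s * s :=
    ⟨CFC.sqrt a, (CFC.sqrt_nonneg a).isSelfAdjoint, (CFC.sqrt_mul_sqrt_self a ha).symm⟩
  have hsd : s * d = 0 := by
    rw [← CStarRing.star_mul_self_eq_zero_iff, star_mul, hs.star_eq]
    simpa only [mul_assoc] using hzero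
  exact hau.mul_right_eq_zero.mp (by rw [mul_assoc, hsd, mul_zero])

/-- An element intertwining the squares of two positive elements, one of them invertible,
intertwines the elements themselves. -/
theorem mul_eq_mul_of_sq_mul_eq_mul_sq {A : Type*} [CStarAlgebra A] [PartialOrder A]
    [StarOrderedRing A] {a b z : A} (ha : 0 ≤ a) (hau : IsUnit a) (hb : 0 ≤ b)
    (h : a * a * z = z * (b * b)) : a * z = z * b := by
  refine sub_eq_zero.mp (eq_zero_of_mul_add_mul_eq_zero ha hau hb ?_)
  calc a * (a * z - z * b) + (a * z - z * b) * b = a * a * z - z * (b * b) := by noncomm_ring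
    _ = 0 := sub_eq_zero.mpr h

theorem one_sub_mul_star_self_nonneg {A : Type*} [CStarAlgebra A] [PartialOrder A]
    [StarOrderedRing A] {z : A} (hz : ‖z‖ < 1) : 0 ≤ 1 - z * star z := by
  rw [sub_nonneg, ← CStarAlgebra.norm_le_one_iff_of_nonneg _ (mul_star_self_nonneg z),
    CStarRing.norm_self_mul_star]
  nlinarith [norm_nonneg z]

theorem isUnit_one_sub_mul_star_self {A : Type*} [CStarAlgebra A] {z : A} (hz : ‖z‖ < 1) :
    IsUnit (1 - z * star z) := by
  apply isUnit_one_sub_of_norm_lt_one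
  rw [CStarRing.norm_self_mul_star]
  nlinarith [norm_nonneg z]

theorem isUnit_and_mul_eq_one_of_mul_mul_eq_one {M : Type*} [Monoid M] {u m : M}
    (h : u * (m * u) = 1) : IsUnit u ∧ u * u * m = 1 ∧ m * (u * u) = 1 := by
  have h' : u * m * u = 1 := by rwa [mul_assoc]
  have hcomm : u * m = m * u := left_inv_eq_right_inv h' h
  refine ⟨⟨⟨u, m * u, h, hcomm ▸ h'⟩, rfl⟩, ?_, ?_⟩
  · rw [mul_assoc, hcomm, h]
  · rw [← mul_assoc, ← hcomm, h']

section Conjugation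

set_option linter.unusedSectionVars false

theorem conjOp_apply (J : H →L⋆[ℂ] H) (A : H →L[ℂ] H) (x : H) : conjOp J A x = J (A (J x)) := rfl

theorem conjOp_one {J : H →L⋆[ℂ] H} (hJinv : ∀ x, J (J x) = x) :
    conjOp J (1 : H →L[ℂ] H) = 1 := by
  ext x
  simp [conjOp_apply, hJinv]

theorem conjOp_sub (J : H →L⋆[ℂ] H) (A B : H →L[ℂ] H) :
    conjOp J (A - B) = conjOp J A - conjOp J B := by
  ext x
  simp [conjOp_apply]

theorem conjOp_mul {J : H →L⋆[ℂ] H} (hJinv : ∀ x, J (J x) = x) (A B : H →L[ℂ] H) :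
    conjOp J (A * B) = conjOp J A * conjOp J B := by
  ext x
  simp [conjOp_apply, hJinv]

theorem conjOp_conjOp {J : H →L⋆[ℂ] H} (hJinv : ∀ x, J (J x) = x) (A : H →L[ℂ] H) :
    conjOp J (conjOp J A) = A := by
  ext x
  simp [conjOp_apply, hJinv]

/-- A conjugate-linear isometry reverses the inner product. -/
theorem inner_map_map_of_norm_map {J : H →L⋆[ℂ] H} (hJnorm : ∀ x, ‖J x‖ = ‖x‖) (x y : H) :
    ⟪J x, J y⟫_ℂ = ⟪y, x⟫_ℂ := by
  have hI : ∀ z, Complex.I • J z = J (-(Complex.I • z)) := fun z ↦ by simp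
  rw [inner_eq_sum_norm_sq_div_four (J x) (J y), inner_eq_sum_norm_sq_div_four y x]
  simp only [RCLike.I_to_complex, hI, ← map_add, ← map_sub, hJnorm]
  have h₁ : ‖x - -(Complex.I • y)‖ = ‖y - Complex.I • x‖ := by
    rw [← norm_neg, ← one_mul ‖y - _‖, ← Complex.norm_I, ← norm_smul, ← norm_neg]
    congr 1
    simp only [smul_sub, smul_smul, Complex.I_mul_I]
    module
  have h₂ : ‖x + -(Complex.I • y)‖ = ‖y + Complex.I • x‖ := by
    rw [← one_mul ‖y + _‖, ← Complex.norm_I, ← norm_smul, ← norm_neg]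
    congr 1
    simp only [smul_add, smul_smul, Complex.I_mul_I]
    module
  rw [h₁, h₂, add_comm x y, norm_sub_rev x y]

theorem star_conjOp {J : H →L⋆[ℂ] H} (hJinv : ∀ x, J (J x) = x) (hJnorm : ∀ x, ‖J x‖ = ‖x‖)
    (A : H →L[ℂ] H) : star (conjOp J A) = conjOp J (star A) := by
  refine ((eq_adjoint_iff _ _).mpr fun x y ↦ ?_).symm
  calc ⟪J (adjoint A (J x)), y⟫_ℂ = ⟪J y, adjoint A (J x)⟫_ℂ := by
        rw [← inner_map_map_of_norm_map hJnorm, hJinv]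
    _ = ⟪A (J y), J x⟫_ℂ := adjoint_inner_right A (J y) (J x)
    _ = ⟪x, J (A (J y))⟫_ℂ := by rw [← inner_map_map_of_norm_map hJnorm, hJinv]

theorem conjOp_nonneg {J : H →L⋆[ℂ] H} (hJinv : ∀ x, J (J x) = x) (hJnorm : ∀ x, ‖J x‖ = ‖x‖)
    {A : H →L[ℂ] H} (hA : 0 ≤ A) : 0 ≤ conjOp J A := by
  obtain ⟨B, rfl⟩ := CStarAlgebra.nonneg_iff_eq_star_mul_self.mp hA
  rw [conjOp_mul hJinv, ← star_conjOp hJinv hJnorm]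
  exact star_mul_self_nonneg _

theorem transp_mul {J : H →L⋆[ℂ] H} (hJinv : ∀ x, J (J x) = x) (A B : H →L[ℂ] H) :
    transp J (A * B) = transp J B * transp J A := by
  simp only [transp, ← star_eq_adjoint, star_mul, conjOp_mul hJinv]

end Conjugation

/-- For transposition-symmetric `Z` with `‖Z‖ < 1`, the operator `1 − Z Z*` is positive and
invertible; with `U := (1 − Z Z*)^(−1/2)` (i.e. the positive operator `U` with
`U (1 − Z Z*) U = 1`) and `V := U Z`, the pair `(U,V)` satisfies the symplectic relations and
`ζ(U,V; 0) = (U*)⁻¹ Vᵀ = Z`. -/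
theorem statement12 (J : H →L⋆[ℂ] H) (hJinv : ∀ x, J (J x) = x) (hJnorm : ∀ x, ‖J x‖ = ‖x‖)
    (Z : H →L[ℂ] H) (hZsym : Z = transp J Z) (hZ : ‖Z‖ < 1) :
    (1 - Z ∘L adjoint Z).IsPositive ∧ IsUnit (1 - Z ∘L adjoint Z) ∧
    ∀ U : H →L[ℂ] H, U.IsPositive → U ∘L (1 - Z ∘L adjoint Z) ∘L U = 1 →
      SymplecticPair J U (U ∘L Z) ∧
      zeta J U (U ∘L Z) 0 = Z ∧
      Ring.inverse (adjoint U) ∘L transp J (U ∘L Z) = Z := by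
  refine ⟨(nonneg_iff_isPositive _).mp (one_sub_mul_star_self_nonneg hZ),
    isUnit_one_sub_mul_star_self hZ, fun U hU hUM ↦ ?_⟩
  replace hU : 0 ≤ U := (nonneg_iff_isPositive U).mpr hU
  replace hUM : U * ((1 - Z * star Z) * U) = 1 := hUM
  have hUs : star U = U := hU.isSelfAdjoint.star_eq
  obtain ⟨hUu, hUUM, -⟩ := isUnit_and_mul_eq_one_of_mul_mul_eq_one hUM
  set W := conjOp J U
  have hW : 0 ≤ W := conjOp_nonneg hJinv hJnorm hU
  have hUt : transp J U = W := by rw [transp, ← star_eq_adjoint, hUs]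
  have hconjZ : conjOp J Z = star Z := by
    conv_lhs => rw [hZsym]
    exact conjOp_conjOp hJinv _
  have hconjZs : conjOp J (star Z) = Z := hZsym.symm
  have hWN : W * ((1 - star Z * Z) * W) = 1 := by
    simpa only [conjOp_mul hJinv, conjOp_sub, conjOp_one hJinv, hconjZ, hconjZs]
      using congrArg (conjOp J) hUM
  obtain ⟨-, -, hNWW⟩ := isUnit_and_mul_eq_one_of_mul_mul_eq_one hWN
  have hsq : U * U * Z = Z * (W * W) :=
    calc U * U * Z = U * U * Z * ((1 - star Z * Z) * (W * W)) := by rw [hNWW, mul_one]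
      _ = U * U * (1 - Z * star Z) * Z * (W * W) := by noncomm_ring
      _ = Z * (W * W) := by rw [hUUM, one_mul]
  have hUZ : U * Z = Z * W := mul_eq_mul_of_sq_mul_eq_mul_sq hU hUu hW hsq
  have hVt : transp J (U * Z) = Z * W := by rw [transp_mul hJinv, ← hZsym, hUt]
  have hVc : conjOp J (U * Z) = W * star Z := by rw [conjOp_mul hJinv, hconjZ]
  have hinv : Ring.inverse (star U) * transp J (U * Z) = Z := by
    rw [hVt, ← hUZ, hUs, Ring.inverse_mul_cancel_left _ _ hUu]
  refine ⟨⟨?_, ?_, ?_, ?_⟩, ?_, hinv⟩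
  · change U * star U - U * Z * star (U * Z) = 1
    rw [star_mul, hUs, ← hUM]
    noncomm_ring
  · change U * transp J (U * Z) = U * Z * transp J U
    rw [hVt, hUt, mul_assoc]
  · change star U * U - transp J (U * Z) * conjOp J (U * Z) = 1
    calc star U * U - transp J (U * Z) * conjOp J (U * Z)
        = U * U - Z * (W * W) * star Z := by rw [hUs, hVt, hVc]; noncomm_ring
      _ = U * U * (1 - Z * star Z) := by rw [← hsq]; noncomm_ring
      _ = 1 := hUUM
  · change transp J U * conjOp J (U * Z) = star (U * Z) * U
    have hsq' := congrArg star hsq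
    simp only [star_mul, hUs, hW.isSelfAdjoint.star_eq] at hsq'
    rw [hUt, hVc, star_mul, hUs, mul_assoc, hsq', mul_assoc]
  · change Ring.inverse (star U + 0 * star (U * Z)) * (transp J (U * Z) + 0 * transp J U) = Z
    rw [zero_mul, zero_mul, add_zero, add_zero, hinv]
end

section
/- Let H be a complex separable Hilbert space with a conjugation J, and let A be a compact linear operator on H that is transposition-symmetric, A = J∘A*∘J. Then there exist a countable orthonormal family (e_i)_{i∈I} in H and strictly positive real numbers (α_i)_{i∈I}, with only finitely many α_i ≥ ε for each ε > 0, such that A x = ∑'_{i∈I} α_i ⟪J e_i, x⟫ e_i for every x ∈ H (the sum converging in H). -/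
open ContinuousLinearMap
open scoped InnerProductSpace

variable {H : Type*} [NormedAddCommGroup H] [InnerProductSpace ℂ H] [CompleteSpace H]

/-- A nonzero compact conjugate-linear operator that is symmetric, `⟪B x, y⟫ = ⟪B y, x⟫`, has a unit
eigenvector with positive eigenvalue. -/
theorem exists_unit_eigenvector_of_conjLinear_ne_zero {K : Type*} [NormedAddCommGroup K]
    [InnerProductSpace ℂ K] [CompleteSpace K] (B : K →L⋆[ℂ] K) (hB : IsCompactOperator (⇑B))
    (hsym : ∀ x y, ⟪B x, y⟫_ℂ = ⟪B y, x⟫_ℂ) (hne : B ≠ 0) :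
    ∃ v : K, ‖v‖ = 1 ∧ ∃ α : ℝ, 0 < α ∧ B v = (α : ℂ) • v := by
  let _ : InnerProductSpace ℝ K := InnerProductSpace.complexToReal
  let T : K →L[ℝ] K :=
    { toFun := B
      map_add' := map_add B
      map_smul' := fun r x => by
        rw [← Complex.coe_smul r x, map_smulₛₗ, Complex.conj_ofReal, Complex.coe_smul]; rfl
      cont := B.continuous }
  have hT : IsCompactOperator T := hB
  have hTsym : T.IsSymmetric := fun x y => by
    change (⟪B x, y⟫_ℂ).re = (⟪x, B y⟫_ℂ).re
    rw [hsym, ← inner_conj_symm, Complex.conj_re]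
  have hT0 : T ≠ 0 := fun h => hne (by
    ext x
    exact congrArg (fun S : K →L[ℝ] K => S x) h)
  rw [Ne, ← eq_zero_of_forall_hasEigenvalue_eq_zero hT hTsym] at hT0
  push Not at hT0
  obtain ⟨μ, hμ, hμ0⟩ := hT0
  obtain ⟨u, hu⟩ := hμ.exists_hasEigenvector
  have hu0 : ‖u‖ ≠ 0 := norm_ne_zero_iff.2 hu.2
  have hBu : B u = (μ : ℂ) • u := by
    rw [Complex.coe_smul]
    exact hu.apply_eq_smul
  have hunit : ∀ c : ℂ, ‖c‖ = 1 → ‖(c * (‖u‖⁻¹ : ℝ)) • u‖ = 1 := fun c hc => by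
    rw [norm_smul, norm_mul, hc, Complex.norm_real, norm_inv, norm_norm, one_mul,
      inv_mul_cancel₀ hu0]
  rcases lt_or_gt_of_ne hμ0 with hneg | hpos
  · refine ⟨_, hunit Complex.I Complex.norm_I, -μ, neg_pos.2 hneg, ?_⟩
    rw [map_smulₛₗ, hBu, smul_smul, smul_smul, map_mul, Complex.conj_I, Complex.conj_ofReal]
    congr 1
    push_cast
    ring
  · refine ⟨_, hunit 1 norm_one, μ, hpos, ?_⟩
    rw [map_smulₛₗ, hBu, smul_smul, smul_smul, map_mul, map_one, Complex.conj_ofReal]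
    congr 1
    ring

/-- A compact conjugate-linear operator has only finitely many eigenvalues of size at least `ε`
along an orthonormal family of eigenvectors. -/
theorem finite_setOf_le_of_conjLinear_eigenvectors {ι K : Type*} [NormedAddCommGroup K]
    [InnerProductSpace ℂ K] {B : K →L⋆[ℂ] K} (hB : IsCompactOperator (⇑B)) {e : ι → K}
    (he : Orthonormal ℂ e) {α : ι → ℝ} (hα : ∀ i, B (e i) = (α i : ℂ) • e i)
    {ε : ℝ} (hε : 0 < ε) : {i | ε ≤ α i}.Finite := by
  by_contra hinf
  let f := Set.Infinite.natEmbedding _ hinf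
  obtain ⟨C, hC, hsub⟩ := IsCompactOperator.image_closedBall_subset_compact
    (f := (B : K →ₛₗ[starRingEnd ℂ] K)) hB 1
  obtain ⟨a, -, φ, hφ, hlim⟩ := hC.tendsto_subseq (x := fun n => B (e (f n))) fun n =>
    hsub ⟨e (f n), by simp [he.1], rfl⟩
  obtain ⟨N, hN⟩ := Metric.cauchySeq_iff.1 hlim.cauchySeq ε hε
  have hlt := hN N le_rfl (N + 1) (Nat.le_succ N)
  have hij : (f (φ N) : ι) ≠ f (φ (N + 1)) := fun h =>
    (hφ (Nat.lt_succ_self N)).ne (f.injective (Subtype.ext h))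
  have hle : ε ≤ α (f (φ N)) := (f (φ N)).2
  have hinner : ⟪e (f (φ N)), B (e (f (φ N))) - B (e (f (φ (N + 1))))⟫_ℂ = α (f (φ N)) := by
    rw [hα, hα, inner_sub_right, inner_smul_right, inner_smul_right, he.2 hij,
      inner_self_eq_norm_sq_to_K, he.1]
    simp
  have hbound := norm_inner_le_norm (𝕜 := ℂ) (e (f (φ N)))
    (B (e (f (φ N))) - B (e (f (φ (N + 1)))))
  rw [hinner, he.1, one_mul, Complex.norm_real, Real.norm_eq_abs, ← dist_eq_norm] at hbound
  exact absurd (hle.trans ((le_abs_self _).trans hbound)) (not_le.2 hlt)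

/-- For a compact symmetric conjugate-linear operator `B` there is an orthonormal set of
eigenvectors with positive eigenvalues whose orthogonal complement is annihilated by `B`. -/
theorem exists_orthonormal_eigenvectors_of_conjLinear (B : H →L⋆[ℂ] H)
    (hB : IsCompactOperator (⇑B)) (hsym : ∀ x y, ⟪B x, y⟫_ℂ = ⟪B y, x⟫_ℂ) :
    ∃ s : Set H, Orthonormal ℂ (Subtype.val : s → H) ∧
      (∀ v ∈ s, ∃ α : ℝ, 0 < α ∧ B v = (α : ℂ) • v) ∧
      ∀ x, (∀ v ∈ s, ⟪v, x⟫_ℂ = 0) → B x = 0 := by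
  obtain ⟨s, hs⟩ := zorn_subset {s : Set H | Orthonormal ℂ (Subtype.val : s → H) ∧
      ∀ v ∈ s, ∃ α : ℝ, 0 < α ∧ B v = (α : ℂ) • v} fun c hc cc =>
    ⟨⋃₀ c, ⟨orthonormal_sUnion_of_directed cc.directedOn fun a ha => (hc ha).1,
      fun v ⟨a, ha, hv⟩ => (hc ha).2 v hv⟩, fun _ => Set.subset_sUnion_of_mem⟩
  refine ⟨s, hs.prop.1, hs.prop.2, ?_⟩
  let K : Submodule ℂ H := (Submodule.span ℂ s)ᗮ
  have hK : ∀ x, x ∈ K ↔ ∀ v ∈ s, ⟪v, x⟫_ℂ = 0 := fun x => by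
    refine ⟨fun h v hv => (Submodule.mem_orthogonal _ _).1 h v (Submodule.subset_span hv),
      fun h => (Submodule.mem_orthogonal _ _).2 fun u hu => ?_⟩
    induction hu using Submodule.span_induction with
    | mem v hv => exact h v hv
    | zero => exact inner_zero_left _
    | add u v _ _ hu hv => rw [inner_add_left, hu, hv, add_zero]
    | smul c u _ hu => rw [inner_smul_left, hu, mul_zero]
  have hBK : ∀ x : K, B x ∈ K := fun x => (hK _).2 fun v hv => by
    obtain ⟨α, -, hα⟩ := hs.prop.2 v hv
    rw [← inner_conj_symm, hsym, hα, inner_smul_left, (hK _).1 x.2 v hv, mul_zero, map_zero]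
  let S : K →L⋆[ℂ] K := (B.comp K.subtypeL).codRestrict K hBK
  have hS : IsCompactOperator S :=
    IsCompactOperator.codRestrict (hB.comp_clm K.subtypeL) hBK
      (Submodule.isClosed_orthogonal _)
  by_contra! hne
  obtain ⟨x, hx, hBx⟩ := hne
  obtain ⟨v, hv, α, hα, hSv⟩ := exists_unit_eigenvector_of_conjLinear_ne_zero S hS
    (fun x y => hsym x y) fun h => hBx
      (congrArg (fun R : K →L⋆[ℂ] K => (R ⟨x, (hK x).2 hx⟩ : H)) h)
  have hvs : ∀ u ∈ s, ⟪u, (v : H)⟫_ℂ = 0 := (hK _).1 v.2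
  have hv1 : ⟪(v : H), (v : H)⟫_ℂ = 1 := by
    rw [inner_self_eq_norm_sq_to_K, Submodule.norm_coe, hv]
    simp
  have hins : insert (v : H) s ∈ {s : Set H | Orthonormal ℂ (Subtype.val : s → H) ∧
      ∀ v ∈ s, ∃ α : ℝ, 0 < α ∧ B v = (α : ℂ) • v} := by
    classical
    refine ⟨orthonormal_subtype_iff_ite.2 ?_, ?_⟩
    · have hne : ∀ u ∈ s, u ≠ (v : H) := fun u hu h => by
        have := hvs u hu
        rw [h, hv1] at this
        exact one_ne_zero this
      rintro u (rfl | hu) w (rfl | hw)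
      · rw [if_pos rfl, hv1]
      · rw [if_neg (hne w hw).symm, ← inner_conj_symm, hvs w hw, map_zero]
      · rw [if_neg (hne u hu), hvs u hu]
      · exact orthonormal_subtype_iff_ite.1 hs.prop.1 u hu w hw
    · rintro u (rfl | hu)
      · exact ⟨α, hα, congrArg Subtype.val hSv⟩
      · exact hs.prop.2 u hu
  have hmem : (v : H) ∈ s := hs.le_of_ge hins (Set.subset_insert _ _) (Set.mem_insert _ _)
  have := hvs v hmem
  rw [hv1] at this
  exact one_ne_zero this

/-- If the conjugate-linear operator `B` annihilates the orthogonal complement of an orthonormal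
set `s`, then `B y` is the sum of the images under `B` of the components of `y` along `s`. -/
theorem hasSum_conjLinear_apply {B : H →L⋆[ℂ] H} {s : Set H}
    (hs : Orthonormal ℂ (Subtype.val : s → H))
    (hker : ∀ x, (∀ v ∈ s, ⟪v, x⟫_ℂ = 0) → B x = 0) (y : H) :
    HasSum (fun v : s => ⟪y, (v : H)⟫_ℂ • B v) (B y) := by
  obtain ⟨w, b, hsw, hb⟩ := hs.exists_hilbertBasis_extension
  have hsum : HasSum (fun v : w => ⟪y, (v : H)⟫_ℂ • B v) (B y) := by
    convert (b.hasSum_repr y).map B B.continuous using 1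
    ext v
    simp [b.repr_apply_apply, hb]
  refine ((Set.inclusion_injective hsw).hasSum_iff ?_).2 hsum
  intro v hv
  rw [Set.range_inclusion] at hv
  have hBv : B v = 0 := hker v fun u hu => by
    have horth := b.orthonormal.2 (i := ⟨u, hsw hu⟩) (j := v) fun h => hv (h ▸ hu)
    simpa [hb] using horth
  rw [hBv, smul_zero]

/-- A norm-preserving conjugate-linear operator reverses inner products. -/
theorem inner_conjugation_conjugation {K : Type*} [NormedAddCommGroup K] [InnerProductSpace ℂ K]
    {J : K →L⋆[ℂ] K} (hJnorm : ∀ x, ‖J x‖ = ‖x‖) (x y : K) :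
    ⟪J x, J y⟫_ℂ = ⟪y, x⟫_ℂ := by
  have hI : Complex.I • J y = J (-(Complex.I • y)) := by simp
  rw [← inner_conj_symm y x, inner_eq_sum_norm_sq_div_four, inner_eq_sum_norm_sq_div_four x y]
  simp only [RCLike.I_to_complex, hI, ← map_add, ← map_sub, hJnorm]
  have h4 : starRingEnd ℂ 4 = 4 := Complex.conj_ofNat 4
  simp only [map_div₀, map_add, map_sub, map_mul, map_pow, Complex.coe_algebraMap,
    Complex.conj_ofReal, Complex.conj_I, h4, ← sub_eq_add_neg, sub_neg_eq_add]
  ring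

/-- If `A` is transposition-symmetric with respect to `J`, then `A ∘ J` is symmetric. -/
theorem inner_comp_conjugation_symm {J : H →L⋆[ℂ] H} (hJinv : ∀ x, J (J x) = x)
    (hJnorm : ∀ x, ‖J x‖ = ‖x‖) {A : H →L[ℂ] H} (hAsym : A = transp J A) (x y : H) :
    ⟪A (J x), y⟫_ℂ = ⟪A (J y), x⟫_ℂ := by
  have hAx : A (J x) = J (adjoint A x) := by
    conv_lhs => rw [hAsym]
    simp [transp, conjOp, hJinv]
  rw [hAx, ← hJinv y, inner_conjugation_conjugation hJnorm, adjoint_inner_right, hJinv]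

/-- A compact transposition-symmetric operator `A` on a separable complex Hilbert space has a
diagonalization `A x = ∑' i, α_i ⟪J e_i, x⟫ e_i` with a countable orthonormal family `(e_i)`,
strictly positive coefficients `α_i`, only finitely many of which exceed any `ε > 0`. -/
theorem statement16 [TopologicalSpace.SeparableSpace H]
    (J : H →L⋆[ℂ] H) (hJinv : ∀ x, J (J x) = x) (hJnorm : ∀ x, ‖J x‖ = ‖x‖)
    (A : H →L[ℂ] H) (hA : IsCompactOperator (⇑A)) (hAsym : A = transp J A) :
    ∃ (I : Type) (_ : Countable I) (e : I → H) (α : I → ℝ),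
      Orthonormal ℂ e ∧ (∀ i, 0 < α i) ∧
      (∀ ε : ℝ, 0 < ε → {i | ε ≤ α i}.Finite) ∧
      ∀ x : H, HasSum (fun i => ((α i : ℂ) * ⟪J (e i), x⟫_ℂ) • e i) (A x) := by
  let B : H →L⋆[ℂ] H := A.comp J
  have hB : IsCompactOperator B := hA.comp_clm J
  obtain ⟨s, hs, heig, hker⟩ := exists_orthonormal_eigenvectors_of_conjLinear B hB
    (inner_comp_conjugation_symm hJinv hJnorm hAsym)
  choose! a ha_pos ha using heig
  have hfin : ∀ ε : ℝ, 0 < ε → {v : s | ε ≤ a v}.Finite := fun ε hε =>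
    finite_setOf_le_of_conjLinear_eigenvectors hB hs (fun v => ha v v.2) hε
  have hcount : Countable s := by
    rw [← Set.countable_univ_iff]
    refine (Set.countable_iUnion fun n : ℕ =>
      (hfin (1 / ((n : ℝ) + 1)) Nat.one_div_pos_of_nat).countable).mono fun v _ => ?_
    obtain ⟨n, hn⟩ := exists_nat_one_div_lt (ha_pos v v.2)
    exact Set.mem_iUnion.2 ⟨n, hn.le⟩
  obtain ⟨f, hf⟩ := exists_injective_nat s
  let g : Set.range f ≃ s := (Equiv.ofInjective f hf).symm
  refine ⟨Set.range f, inferInstance, fun i => g i, fun i => a (g i), hs.comp g g.injective,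
    fun i => ha_pos _ (g i).2,
    fun ε hε => Set.Finite.preimage (f := g) g.injective.injOn (hfin ε hε), fun x => ?_⟩
  have hsum := g.hasSum_iff.2 (hasSum_conjLinear_apply hs hker (J x))
  have hBx : B (J x) = A x := congrArg A (hJinv x)
  rw [hBx] at hsum
  convert hsum using 2 with i
  have hinner : ⟪J (g i), x⟫_ℂ = ⟪J x, (g i : H)⟫_ℂ := by
    rw [← inner_conjugation_conjugation hJnorm, hJinv]
  rw [Function.comp_apply, ha _ (g i).2, smul_smul, hinner, mul_comm]
end
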